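/- Let F be a finitely generated free group and φ : F → F a group endomorphism. Then the stable quotient Q = F / ⨆_{k≥1} ker(φ^k) is a finitely generated free group. -/

import Mathlib

namespace FreeGroup

/-- The elements of the free group represented by the suffixes of a word. -/
def suffixes {α : Type*} (L : List (α × Bool)) : Set (FreeGroup α) :=
  {g | ∃ t, t <:+ L ∧ mk t = g}

lemma finite_suffixes {α : Type*} (L : List (α × Bool)) : (suffixes L).Finite := by
  refine (L.tails.finite_toSet.image mk).subset ?_
  rintro _ ⟨t, ht, rfl⟩
  exact ⟨t, by simpa using ht, rfl⟩

/-- Any finite subset of a group carries, for each `a`, a permutation agreeing with left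
multiplication by `a` wherever the latter stays inside the subset. -/
lemma exists_perm_eq_mul {G : Type*} [Group G] (S : Set G) [Finite S] (a : G) :
    ∃ σ : Equiv.Perm S, ∀ s t : S, (t : G) = a * s → σ s = t := by
  classical
  let e : {s : S // a * s ∈ S} ≃ {s : S // a⁻¹ * s ∈ S} :=
    { toFun := fun s => ⟨⟨a * s.1, s.2⟩, by simp⟩
      invFun := fun s => ⟨⟨a⁻¹ * s.1, s.2⟩, by simp⟩
      left_inv := fun s => by ext; simp
      right_inv := fun s => by ext; simp }
  refine ⟨e.extendSubtype, fun s t h => ?_⟩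
  have hs : a * (s : G) ∈ S := h ▸ t.2
  rw [e.extendSubtype_apply_of_mem s hs]
  exact Subtype.ext h.symm

instance residuallyFinite (α : Type*) : Group.ResiduallyFinite (FreeGroup α) := by
  refine Group.residuallyFinite_of_forall_exists_finite_monoidHom fun g hg => ?_
  obtain ⟨L, rfl⟩ : ∃ L, mk L = g := Quot.exists_rep g
  have := (finite_suffixes L).to_subtype
  choose σ hσ using fun a : α => exists_perm_eq_mul (suffixes L) (of a)
  have key : ∀ t (ht : t <:+ L),
      lift σ (mk t) ⟨mk [], [], List.nil_suffix, rfl⟩ = ⟨mk t, t, ht, rfl⟩ := by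
    intro t
    induction t with
    | nil => intro _; simp [← one_eq_mk]
    | cons x t ih =>
      intro ht
      have ht' : t <:+ L := (List.suffix_cons x t).trans ht
      obtain ⟨a, b⟩ := x
      have hx : (mk ((a, b) :: t) : FreeGroup α) = mk [(a, b)] * mk t := by simp
      cases b with
      | true =>
        replace hx : (mk ((a, true) :: t) : FreeGroup α) = of a * mk t := hx
        conv_lhs => rw [hx, _root_.map_mul, Equiv.Perm.mul_apply, ih ht', lift_apply_of]
        exact hσ a _ _ hx
      | false =>
        replace hx : (mk ((a, false) :: t) : FreeGroup α) = (of a)⁻¹ * mk t := hx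
        conv_lhs =>
          rw [hx, _root_.map_mul, Equiv.Perm.mul_apply, ih ht', _root_.map_inv, lift_apply_of]
        rw [Equiv.Perm.inv_eq_iff_eq]
        exact (hσ a _ _ (eq_inv_mul_iff_mul_eq.mp hx).symm).symm
  refine ⟨Equiv.Perm (suffixes L), inferInstance, inferInstance, lift σ, fun h => hg ?_⟩
  have := key L List.suffix_rfl
  rw [h] at this
  exact (congrArg Subtype.val this).symm

end FreeGroup

section Hom

variable {G H Q : Type*} [Group G] [Group H] [Group Q]

lemma Group.ResiduallyFinite.of_injective [Group.ResiduallyFinite H] (f : G →* H)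
    (hf : Function.Injective f) : Group.ResiduallyFinite G := by
  rw [Group.residuallyFinite_iff_forall_finiteIndexNormalSubgroup]
  intro g hg
  refine hf ((Group.eq_one_iff_forall_finiteIndexNormalSubroup _ fun K => ?_).trans
    (map_one f).symm)
  exact hg (K.comap f)

instance IsFreeGroup.residuallyFinite [IsFreeGroup G] : Group.ResiduallyFinite G :=
  .of_injective (IsFreeGroup.toFreeGroup G).toMonoidHom (IsFreeGroup.toFreeGroup G).injective

instance MonoidHom.finite_of_fg [Group.FG G] [Finite Q] : Finite (G →* Q) := by
  obtain ⟨S, hS⟩ := Group.fg_def.mp ‹Group.FG G›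
  refine Finite.of_injective (fun (f : G →* Q) (s : S) => f s) fun f g h => ?_
  exact MonoidHom.eq_of_eqOn_dense hS fun s hs => congrFun h ⟨s, hs⟩

lemma MonoidHom.comp_right_injective_of_surjective {f : G →* H} (hf : Function.Surjective f) :
    Function.Injective fun g : H →* Q => g.comp f :=
  fun _ _ h => (MonoidHom.cancel_right hf).mp h

/-- A Hopfian property: a surjection out of a finitely generated residually finite group is
injective if source and target have equally many homomorphisms to each finite group. -/
lemma MonoidHom.injective_of_surjective_of_card_le {G H : Type*} [Group G] [Group H]
    [Group.FG G] [Group.ResiduallyFinite G] {f : G →* H} (hf : Function.Surjective f)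
    (h : ∀ N : FiniteIndexNormalSubgroup G,
      Nat.card (G →* G ⧸ N.toSubgroup) ≤ Nat.card (H →* G ⧸ N.toSubgroup)) :
    Function.Injective f := by
  rw [injective_iff_map_eq_one]
  refine fun g hg => Group.eq_one_iff_forall_finiteIndexNormalSubroup g fun N => ?_
  have : Finite (G ⧸ N.toSubgroup) := N.toSubgroup.finite_quotient_of_finiteIndex
  obtain ⟨p, hp⟩ := ((comp_right_injective_of_surjective hf).bijective_of_nat_card_le (h N)).2
    (QuotientGroup.mk' N.toSubgroup)
  have hp' := DFunLike.congr_fun hp g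
  simp only [MonoidHom.comp_apply, hg, map_one] at hp'
  exact (QuotientGroup.eq_one_iff g).mp hp'.symm

lemma IsFreeGroup.finite_generators [IsFreeGroup G] [Group.FG G] :
    Finite (IsFreeGroup.Generators G) := by
  by_contra hX
  rw [not_finite_iff_infinite] at hX
  have : Finite (IsFreeGroup.Generators G → Multiplicative (ZMod 2)) :=
    .of_equiv _ (IsFreeGroup.lift (G := G)).symm
  exact not_finite (IsFreeGroup.Generators G → Multiplicative (ZMod 2))

lemma IsFreeGroup.card_monoidHom [IsFreeGroup G] [Group.FG G] :
    Nat.card (G →* Q) = Nat.card Q ^ Nat.card (IsFreeGroup.Generators G) := by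
  have := IsFreeGroup.finite_generators (G := G)
  rw [← Nat.card_fun, Nat.card_congr IsFreeGroup.lift]

lemma IsFreeGroup.card_generators_le_of_surjective [IsFreeGroup G] [Group.FG G] [IsFreeGroup H]
    [Group.FG H] {f : G →* H} (hf : Function.Surjective f) :
    Nat.card (IsFreeGroup.Generators H) ≤ Nat.card (IsFreeGroup.Generators G) := by
  have h := Nat.card_le_card_of_injective _
    (MonoidHom.comp_right_injective_of_surjective (Q := Multiplicative (ZMod 2)) hf)
  rw [card_monoidHom, card_monoidHom] at h
  refine (Nat.pow_le_pow_iff_right ?_).mp h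
  exact Finite.one_lt_card

lemma IsFreeGroup.injective_of_surjective [IsFreeGroup G] [Group.FG G] [IsFreeGroup H]
    [Group.FG H] {f : G →* H} (hf : Function.Surjective f)
    (h : Nat.card (IsFreeGroup.Generators G) = Nat.card (IsFreeGroup.Generators H)) :
    Function.Injective f :=
  MonoidHom.injective_of_surjective_of_card_le hf fun N => by
    rw [card_monoidHom, card_monoidHom, h]

end Hom

namespace Monoid.End

variable {F : Type*} [Group F] (φ : Monoid.End F)

lemma pow_succ_apply (k : ℕ) (x : F) : (φ ^ (k + 1)) x = φ ((φ ^ k) x) := by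
  rw [pow_succ']
  rfl

/-- The surjection from the range of `φ ^ k` onto the range of `φ ^ (k + 1)` induced by `φ`. -/
def rangePowStep (k : ℕ) : MonoidHom.range (φ ^ k) →* MonoidHom.range (φ ^ (k + 1)) :=
  (φ.comp (MonoidHom.range (φ ^ k)).subtype).codRestrict _ fun x => by
    obtain ⟨y, hy⟩ := x.2
    exact ⟨y, (pow_succ_apply φ k y).trans (congrArg φ hy)⟩

lemma rangePowStep_surjective (k : ℕ) : Function.Surjective (rangePowStep φ k) := by
  rintro ⟨_, y, rfl⟩
  exact ⟨⟨(φ ^ k) y, y, rfl⟩, Subtype.ext (pow_succ_apply φ k y).symm⟩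

lemma ker_pow_le_ker_pow_succ (k : ℕ) :
    MonoidHom.ker (φ ^ k) ≤ MonoidHom.ker (φ ^ (k + 1)) := by
  intro x (hx : (φ ^ k) x = 1)
  exact (pow_succ_apply φ k x).trans ((congrArg φ hx).trans (map_one φ))

lemma ker_pow_succ_le_ker_pow {k : ℕ} (h : Function.Injective (rangePowStep φ k)) :
    MonoidHom.ker (φ ^ (k + 1)) ≤ MonoidHom.ker (φ ^ k) := by
  intro x (hx : (φ ^ (k + 1)) x = 1)
  have hx' : rangePowStep φ k ⟨(φ ^ k) x, x, rfl⟩ = 1 :=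
    Subtype.ext ((pow_succ_apply φ k x).symm.trans hx)
  exact congrArg Subtype.val (h (hx'.trans (map_one _).symm))

/-- The kernels of the powers of an endomorphism of a finitely generated free group stabilize. -/
lemma exists_ker_pow_eq [IsFreeGroup F] [Group.FG F] :
    ∃ K, ∀ k ≥ K, MonoidHom.ker (φ ^ k) = MonoidHom.ker (φ ^ K) := by
  let r (k : ℕ) : ℕ := Nat.card (IsFreeGroup.Generators (MonoidHom.range (φ ^ k)))
  have hr : Antitone r := antitone_nat_of_succ_le fun k =>
    IsFreeGroup.card_generators_le_of_surjective (rangePowStep_surjective φ k)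
  obtain ⟨K, hK⟩ := WellFoundedLT.antitone_chain_condition hr
  refine ⟨K, fun k hk => ?_⟩
  induction k, hk using Nat.le_induction with
  | base => rfl
  | succ k hk ih =>
    rw [← ih]
    refine le_antisymm (ker_pow_succ_le_ker_pow φ ?_) (ker_pow_le_ker_pow_succ φ k)
    exact IsFreeGroup.injective_of_surjective (rangePowStep_surjective φ k)
      ((hK k hk).symm.trans (hK (k + 1) (hk.trans k.le_succ)))

end Monoid.End

theorem stmt_2 (F : Type*) [Group F] [IsFreeGroup F] [Group.FG F] (φ : Monoid.End F)
    [hN : (⨆ k ≥ 1, MonoidHom.ker (φ ^ k)).Normal] :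
    IsFreeGroup (F ⧸ ⨆ k ≥ 1, MonoidHom.ker (φ ^ k)) ∧
      Group.FG (F ⧸ ⨆ k ≥ 1, MonoidHom.ker (φ ^ k)) := by
  refine ⟨?_, inferInstance⟩
  obtain ⟨K, hK⟩ := Monoid.End.exists_ker_pow_eq φ
  have hmono : Monotone fun k => MonoidHom.ker (φ ^ k) :=
    monotone_nat_of_le_succ (Monoid.End.ker_pow_le_ker_pow_succ φ)
  have hsup : MonoidHom.ker (φ ^ (K + 1)) = ⨆ k ≥ 1, MonoidHom.ker (φ ^ k) := by
    refine le_antisymm (le_iSup₂_of_le (K + 1) (Nat.le_add_left 1 K) le_rfl)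
      (iSup₂_le fun k _ => ?_)
    rcases le_total k (K + 1) with h | h
    · exact hmono h
    · exact ((hK k (K.le_succ.trans h)).trans (hK (K + 1) K.le_succ).symm).le
  exact IsFreeGroup.ofMulEquiv ((QuotientGroup.quotientKerEquivRange (φ ^ (K + 1))).symm.trans
    (QuotientGroup.quotientMulEquivOfEq hsup))
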